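/- Let P ⊆ ℂ be nonempty, compact and contractible with empty interior in ℂ, and let A, B : P → ℂ^{n×n} be continuous maps such that A(θ) and B(θ) are upper triangular (all entries below the diagonal vanish) for every θ ∈ P. If B(θ) is invertible for every θ ∈ P and each diagonal entry a_{ii} : P → ℂ of A (i = 1, …, n) is injective, then (A, B) is uniformly ensemble reachable on C(P, ℂ^n). -/

import Mathlib

open Polynomial Matrix

/-- Uniform ensemble reachability of a pair `(A, B)` on `C(P, ℂ^ι)`. -/
def UniformEnsembleReachable {ι κ : Type*} [Fintype ι] [DecidableEq ι] [Fintype κ]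
    (P : Set ℂ) (A : P → Matrix ι ι ℂ) (B : P → Matrix ι κ ℂ) : Prop :=
  ∀ f : P → ι → ℂ, Continuous f → ∀ ε : ℝ, 0 < ε →
    ∃ p : κ → Polynomial ℂ, ∀ θ : P,
      ‖(∑ j : κ, (Polynomial.aeval (A θ) (p j)).mulVec fun i => B θ i j) - f θ‖ < ε

namespace Lav
open Set Filter Topology Metric


/-- Logarithm along a homotopy of non-vanishing functions. -/
theorem log_path {X : Type*} [TopologicalSpace X] [CompactSpace X]
    (F : C(unitInterval × X, ℂ)) (hF : ∀ p, F p ≠ 0) :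
    ∃ h : C(X, ℂ), ∀ x, F (1, x) = F (0, x) * Complex.exp (h x) := by
  have key := PreconnectedSpace.induction₂' (α := unitInterval)
    (fun s t => ∃ h : C(X, ℂ), ∀ x, F (t, x) = F (s, x) * Complex.exp (h x)) ?_ ?_ 0 1
  · exact key
  · intro s
    let G : C(unitInterval × X, ℂ) :=
      ⟨fun p => F p / F (s, p.2), by
        refine Continuous.div (by fun_prop) (by fun_prop) (fun p => hF _)⟩
    have h1 : ContinuousAt (fun t => G.curry t) s := G.curry.continuous.continuousAt
    have h2 := Metric.continuousAt_iff'.1 h1 (1/2) (by norm_num)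
    filter_upwards [h2] with t ht
    have h3 : ∀ x, ‖F (t, x) / F (s, x) - 1‖ < 1/2 := by
      intro x
      have := (ContinuousMap.dist_lt_iff (by norm_num)).1 ht x
      rw [dist_eq_norm] at this
      simpa [G, hF] using this
    have h4 : ∀ x, F (t, x) / F (s, x) ∈ Complex.slitPlane := by
      intro x
      apply Complex.mem_slitPlane_of_norm_lt_one (z := F (t, x) / F (s, x) - 1) _ |> (by simpa using ·)
      linarith [h3 x]
    let h : C(X, ℂ) := ⟨fun x => Complex.log (F (t, x) / F (s, x)), by
      refine Continuous.clog (Continuous.div (by fun_prop) (by fun_prop) (fun p => hF _)) h4⟩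
    have h5 : ∀ x, Complex.exp (h x) = F (t, x) / F (s, x) := by
      intro x
      exact Complex.exp_log (div_ne_zero (hF _) (hF _))
    refine ⟨⟨h, fun x => ?_⟩, ⟨-h, fun x => ?_⟩⟩
    · rw [h5]; field_simp [hF]
    · have := hF (t, x)
      have := hF (s, x)
      simp only [ContinuousMap.neg_apply, Complex.exp_neg, h5]
      field_simp
  · refine ⟨fun r s t => ?_⟩
    rintro ⟨h, hh⟩ ⟨k, hk⟩
    refine ⟨h + k, fun x => ?_⟩
    rw [hk, hh, ContinuousMap.add_apply, Complex.exp_add]; ring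

/-- A planar Brouwer-type statement. -/
theorem no_ext (G : ℂ → ℂ) (hG : Continuous G) (h0 : ∀ w, G w ≠ 0)
    (h1 : ∀ w, ‖w‖ = 1 → ‖G w - w‖ < 1) : False := by
  obtain ⟨h, hh⟩ := log_path (X := Circle)
    ⟨fun p => G (((p.1 : ℝ) : ℂ) * (p.2 : ℂ)), by fun_prop⟩ (fun p => h0 _)
  replace hh : ∀ x : Circle, G x = G 0 * Complex.exp (h x) := by
    intro x; simpa using hh x
  have hs : ∀ z : Circle, G z / z ∈ Complex.slitPlane := by
    intro z
    have hz : ‖(z : ℂ)‖ = 1 := Circle.norm_coe z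
    have : ‖G z / z - 1‖ < 1 := by
      have h2 : G z / z - 1 = (G z - z) / z := by
        field_simp [Circle.coe_ne_zero z]
      rw [h2, norm_div, hz, div_one]
      exact h1 _ hz
    simpa using Complex.mem_slitPlane_of_norm_lt_one this
  let k : ℝ → ℂ := fun θ => Complex.log (G 0) + h (Circle.exp θ)
    - Complex.log (G (Circle.exp θ) / (Circle.exp θ)) - θ * Complex.I
  have hkc : Continuous k := by
    have : Continuous fun θ : ℝ => Complex.log (G (Circle.exp θ) / (Circle.exp θ)) := by
      refine Continuous.clog (Continuous.div (by fun_prop) (by fun_prop) ?_) (fun θ => hs _)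
      intro θ; exact Circle.coe_ne_zero _
    fun_prop
  have hk1 : ∀ θ, Complex.exp (k θ) = 1 := by
    intro θ
    simp only [k]
    rw [Complex.exp_sub, Complex.exp_sub, Complex.exp_add, Complex.exp_log (h0 _), ← hh,
      Complex.exp_log (Complex.slitPlane_ne_zero (hs _)), ← Circle.coe_exp]
    have := h0 (Circle.exp θ)
    have := Circle.coe_ne_zero (Circle.exp θ)
    field_simp
  have hk2 : k (2 * Real.pi) = k 0 - 2 * Real.pi * Complex.I := by
    simp only [k, Circle.exp_two_pi, Circle.exp_zero]
    push_cast; ring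
  let r : ℝ → ℝ := fun θ => (k θ).im / (2 * Real.pi)
  have hr : ∀ θ, ∃ n : ℤ, r θ = n := by
    intro θ
    obtain ⟨n, hn⟩ := Complex.exp_eq_one_iff.1 (hk1 θ)
    refine ⟨n, ?_⟩
    have := Real.pi_pos
    simp only [r, hn]
    simp
  have hrc : Continuous r := by fun_prop
  have hr2 : r (2 * Real.pi) = r 0 - 1 := by
    have := Real.pi_pos
    simp only [r, hk2]
    simp
    field_simp
  have := intermediate_value_Icc' (by positivity : (0:ℝ) ≤ 2 * Real.pi) hrc.continuousOn
  obtain ⟨θ, -, hθ⟩ := this (show r 0 - 1/2 ∈ _ from ⟨by rw [hr2]; linarith, by linarith⟩)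
  obtain ⟨n, hn⟩ := hr θ
  obtain ⟨m, hm⟩ := hr 0
  rw [hn, hm] at hθ
  have : (2 * n : ℝ) = 2 * m - 1 := by linarith
  have : 2 * n = 2 * m - 1 := by exact_mod_cast this
  omega

theorem preconn_far (R : ℝ) (hR : 0 ≤ R) : IsPreconnected {z : ℂ | R < ‖z‖} := by
  have h1 : IsPreconnected (Ioi R ×ˢ sphere (0:ℂ) 1) :=
    isPreconnected_Ioi.prod (isPreconnected_sphere (by simp [Complex.rank_real_complex]) 0 1)
  have h2 := h1.image (fun p : ℝ × ℂ => (p.1 : ℂ) * p.2) (by fun_prop)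
  convert h2 using 1
  ext z
  simp only [mem_ofPred_eq, mem_image, mem_prod, mem_Ioi, mem_sphere_zero_iff_norm, Prod.exists]
  constructor
  · intro hz
    have : ‖z‖ ≠ 0 := by linarith
    refine ⟨‖z‖, z / ‖z‖, ⟨hz, by simp [this]⟩, ?_⟩
    have : (‖z‖ : ℂ) ≠ 0 := by exact_mod_cast this
    field_simp
  · rintro ⟨r, w, ⟨hr, hw⟩, rfl⟩
    simp only [norm_mul, hw, mul_one, Complex.norm_real, Real.norm_eq_abs]
    exact lt_of_lt_of_le hr (le_abs_self r)

theorem no_bounded_piece {X : Type*} [TopologicalSpace X] [CompactSpace X] [ContractibleSpace X]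
    (a : C(X, ℂ)) (ha : Function.Injective a) (U : Set ℂ) (hU : IsOpen U)
    (hUK : Disjoint U (range a)) (hcl : IsClosed (U ∪ range a)) (p : ℂ) (hp : p ∈ U)
    (R : ℝ) (hR : ∀ z ∈ U, ‖z‖ ≤ R) : False := by
  have hpK : ∀ x, a x - p ≠ 0 := fun x hx =>
    hUK.le_bot ⟨hp, ⟨x, sub_eq_zero.1 hx⟩⟩
  obtain ⟨x0, ⟨H⟩⟩ := id_nullhomotopic X
  let H' := H.symm
  obtain ⟨h, hh⟩ := log_path (X := X) ⟨fun q => a (H' q) - p, by fun_prop⟩ (fun q => hpK _)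
  simp only [ContinuousMap.coe_mk, ContinuousMap.Homotopy.apply_one,
    ContinuousMap.Homotopy.apply_zero, H', ContinuousMap.id_apply, ContinuousMap.const_apply] at hh
  have hemb : IsClosedEmbedding a := a.continuous.isClosedEmbedding ha
  obtain ⟨g, hg⟩ := ContinuousMap.exists_extension hemb h
  have hg' : ∀ x, g (a x) = h x := fun x => DFunLike.congr_fun hg x
  classical
  let F : ℂ → ℂ := fun z => if z ∈ U then (a x0 - p) * Complex.exp (g z) else z - p
  have hF1 : ∀ z ∈ U ∪ range a, F z = (a x0 - p) * Complex.exp (g z) := by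
    intro z hz
    by_cases hzU : z ∈ U
    · simp [F, hzU]
    · rcases hz with hz | ⟨x, rfl⟩
      · exact absurd hz hzU
      · simp only [F, hzU, if_false, hg', ← hh]
  have hF2 : ∀ z ∈ Uᶜ, F z = z - p := fun z hz => by
    have : z ∉ U := hz
    simp [F, this]
  have hFc : Continuous F := by
    rw [← continuousOn_univ]
    have : (univ : Set ℂ) = (U ∪ range a) ∪ Uᶜ := by
      ext z; by_cases hz : z ∈ U <;> simp [hz]
    rw [this]
    refine ContinuousOn.union_of_isClosed ?_ ?_ hcl hU.isClosed_compl
    · exact ContinuousOn.congr (by fun_prop) hF1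
    · exact ContinuousOn.congr (by fun_prop) hF2
  have hF0 : ∀ z, F z ≠ 0 := by
    intro z
    by_cases hz : z ∈ U
    · rw [hF1 z (Or.inl hz)]
      exact mul_ne_zero (hpK _) (Complex.exp_ne_zero _)
    · rw [hF2 z hz]
      intro h; rw [sub_eq_zero] at h; exact hz (h ▸ hp)
  let ρ : ℝ := R + ‖p‖ + 1
  have hρ : 0 < ρ := by
    have := hR p hp
    have := norm_nonneg p
    simp only [ρ]; linarith
  have hρ' : (ρ : ℂ) ≠ 0 := by exact_mod_cast hρ.ne'
  refine no_ext (fun w => F (p + ρ * w) / ρ) (by fun_prop) (fun w => div_ne_zero (hF0 _) hρ') ?_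
  intro w hw
  have : p + ρ * w ∉ U := by
    intro hU
    have h1 := hR _ hU
    have h2 : ‖(ρ:ℂ) * w‖ ≤ ‖p + ρ * w‖ + ‖p‖ := by
      have := norm_sub_le (p + ρ * w) p
      simpa using this
    rw [norm_mul, hw, Complex.norm_real, Real.norm_of_nonneg hρ.le] at h2
    simp only [ρ] at h1 h2; linarith
  simp only [hF2 _ this]
  have : (p + ρ * w - p) / ρ - w = 0 := by field_simp; ring
  rw [this]; simp

theorem compl_preconn {X : Type*} [TopologicalSpace X] [CompactSpace X] [ContractibleSpace X]
    (a : C(X, ℂ)) (ha : Function.Injective a) : IsPreconnected (range a)ᶜ := by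
  have hK : IsCompact (range a) := isCompact_range a.continuous
  obtain ⟨R, hR0, hR⟩ : ∃ R : ℝ, 0 ≤ R ∧ ∀ z ∈ range a, ‖z‖ ≤ R := by
    obtain ⟨R, hR⟩ := hK.isBounded.exists_norm_le
    exact ⟨max R 0, le_max_right _ _, fun z hz => (hR z hz).trans (le_max_left _ _)⟩
  have hfar := preconn_far R hR0
  have hsub : {z : ℂ | R < ‖z‖} ⊆ (range a)ᶜ := fun z hz hz' => not_lt.2 (hR z hz') hz
  have main : ∀ u v : Set ℂ, IsOpen u → IsOpen v → (range a)ᶜ ⊆ u ∪ v →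
      (range a)ᶜ ∩ (u ∩ v) = ∅ → {z : ℂ | R < ‖z‖} ⊆ u → (range a)ᶜ ⊆ u := by
    intro u v hu hv huv hd hfu z hz
    by_contra hzu
    have hzv : z ∈ v := (huv hz).resolve_left hzu
    refine no_bounded_piece a ha (v ∩ (range a)ᶜ) (hv.inter hK.isClosed.isOpen_compl) ?_ ?_
      z ⟨hzv, hz⟩ R ?_
    · exact disjoint_left.2 fun x hx hx' => hx.2 hx'
    · have : v ∩ (range a)ᶜ ∪ range a = (u ∩ (range a)ᶜ)ᶜ := by
        ext x
        have h1 := @huv x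
        have h2 : x ∉ (range a)ᶜ ∩ (u ∩ v) := by rw [hd]; simp
        simp only [mem_union, mem_inter_iff, mem_compl_iff] at h1 h2 ⊢
        tauto
      rw [this]
      exact (hu.inter hK.isClosed.isOpen_compl).isClosed_compl
    · intro w hw
      by_contra hlt
      have h3 := hfu (show R < ‖w‖ from not_le.1 hlt)
      have h2 : w ∉ (range a)ᶜ ∩ (u ∩ v) := by rw [hd]; simp
      exact h2 ⟨hw.2, h3, hw.1⟩
  rw [isPreconnected_iff_subset_of_disjoint]
  intro u v hu hv huv hd
  have hd' : {z : ℂ | R < ‖z‖} ∩ (u ∩ v) = ∅ :=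
    subset_eq_empty (inter_subset_inter_left _ hsub) hd
  rcases isPreconnected_iff_subset_of_disjoint.1 hfar u v hu hv (hsub.trans huv) hd' with h | h
  · exact Or.inl (main u v hu hv huv hd h)
  · refine Or.inr (main v u hv hu (by rwa [union_comm]) (by rwa [inter_comm v u]) h)




theorem analytic_comp {X : Type*} [TopologicalSpace X] [CompactSpace X]
    (S : Subalgebra ℂ C(X, ℂ)) (hS : IsClosed (S : Set C(X, ℂ)))
    (F : ℂ → ℂ) (hF : DifferentiableOn ℂ F (ball 0 1)) (u v : C(X, ℂ)) (hu : u ∈ S)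
    (hu2 : ∀ x, ‖u x‖ ≤ 1/2) (hv : ∀ x, v x = F (u x)) : v ∈ S := by
  have h1 : DifferentiableOn ℂ F (closedBall 0 ((3/4 : NNReal) : ℝ)) :=
    hF.mono (closedBall_subset_ball (by norm_num))
  have h2 := h1.hasFPowerSeriesOnBall (by norm_num)
  have h3 := h2.tendstoUniformlyOn' (r' := 5/8) (by
    rw [ENNReal.coe_lt_coe, ← NNReal.coe_lt_coe]; push_cast; norm_num)
  set p := cauchyPowerSeries F 0 ((3/4 : NNReal) : ℝ)
  rw [← SetLike.mem_coe, ← hS.closure_eq, Metric.mem_closure_iff]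
  intro ε hε
  have h4 := Metric.tendstoUniformlyOn_iff.1 h3 (ε/2) (by positivity)
  obtain ⟨n, hn⟩ := h4.exists
  refine ⟨∑ k ∈ Finset.range n, p.coeff k • u ^ k, ?_, ?_⟩
  · exact S.sum_mem fun k _ => S.smul_mem (S.pow_mem hu k) _
  · refine lt_of_le_of_lt ((ContinuousMap.dist_le (by positivity)).2 fun x => ?_)
      (half_lt_self hε)
    have := hn (u x) (by
      rw [mem_ball_zero_iff]
      refine lt_of_le_of_lt (hu2 x) (by push_cast; norm_num))
    rw [hv]
    refine le_of_eq_of_le ?_ this.le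
    congr 1
    simp only [sub_zero, FormalMultilinearSeries.partialSum,
      FormalMultilinearSeries.apply_eq_pow_smul_coeff]
    simp [ContinuousMap.sum_apply, mul_comm]

/-- principal square root of `1 + w`. -/
theorem exists_sqrt : ∃ F : ℂ → ℂ, DifferentiableOn ℂ F (ball 0 1) ∧
    (∀ w, ‖w‖ < 1 → F w ^ 2 = 1 + w) ∧ ∀ w, ‖w‖ < 1 → ‖F w - 1‖ ≤ ‖w‖ := by
  have hs : ∀ w : ℂ, ‖w‖ < 1 → 1 + w ∈ Complex.slitPlane := fun w hw =>
    Complex.mem_slitPlane_of_norm_lt_one hw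
  have hsq : ∀ w : ℂ, ‖w‖ < 1 → Complex.exp (Complex.log (1 + w) / 2) ^ 2 = 1 + w := by
    intro w hw
    rw [← Complex.exp_nat_mul]
    rw [show ((2:ℕ):ℂ) * (Complex.log (1 + w) / 2) = Complex.log (1+w) by push_cast; ring]
    exact Complex.exp_log (Complex.slitPlane_ne_zero (hs w hw))
  refine ⟨fun w => Complex.exp (Complex.log (1 + w) / 2), ?_, hsq, ?_⟩
  · intro w hw
    have := hs w (by simpa using hw)
    have h1 : DifferentiableAt ℂ (fun w => Complex.log (1 + w)) w :=
      DifferentiableAt.clog (by fun_prop) this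
    exact (h1.div_const 2).cexp.differentiableWithinAt
  · intro w hw
    have h1 := hsq w hw
    set g := Complex.exp (Complex.log (1 + w) / 2) with hg
    have hre : 0 ≤ g.re := by
      rw [hg, Complex.exp_re]
      refine mul_nonneg (Real.exp_pos _).le (Real.cos_nonneg_of_mem_Icc ?_)
      have h2 := Complex.neg_pi_lt_arg (1 + w)
      have h3 := Complex.arg_le_pi (1 + w)
      have h4 : (Complex.log (1 + w) / 2).im = (1 + w).arg / 2 := by
        rw [← Complex.log_im, show Complex.log (1 + w) / 2 = Complex.log (1+w) / ((2:ℝ):ℂ) by push_cast; rfl, Complex.div_ofReal_im]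
      rw [h4]
      constructor <;> linarith
    have h2 : (g - 1) * (g + 1) = w := by linear_combination h1
    have h3 : 1 ≤ ‖g + 1‖ := by
      refine le_trans ?_ (Complex.re_le_norm _)
      simp; exact hre
    calc ‖g - 1‖ ≤ ‖g - 1‖ * ‖g + 1‖ := le_mul_of_one_le_right (norm_nonneg _) h3
      _ = ‖w‖ := by rw [← norm_mul, h2]



section
variable {X : Type*} [TopologicalSpace X] [CompactSpace X]

theorem one_add_inv_mem (S : Subalgebra ℂ C(X, ℂ)) (hS : IsClosed (S : Set C(X, ℂ)))
    (u : C(X, ℂ)) (hu : u ∈ S) (hu2 : ∀ x, ‖u x‖ ≤ 1/2) :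
    ∃ v ∈ S, ∀ x, v x * (1 + u x) = 1 := by
  have hne : ∀ w : ℂ, ‖w‖ < 1 → 1 + w ≠ 0 := fun w hw =>
    Complex.slitPlane_ne_zero (Complex.mem_slitPlane_of_norm_lt_one hw)
  have hne' : ∀ x, 1 + u x ≠ 0 := fun x => hne _ (lt_of_le_of_lt (hu2 x) (by norm_num))
  refine ⟨⟨fun x => (1 + u x)⁻¹, Continuous.inv₀ (by fun_prop) hne'⟩,
    analytic_comp S hS (fun w => (1 + w)⁻¹) ?_ u _ hu hu2 (fun x => rfl), fun x => ?_⟩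
  · intro w hw
    have := hne w (by simpa using hw)
    exact (DifferentiableAt.inv (by fun_prop) this).differentiableWithinAt
  · exact inv_mul_cancel₀ (hne' x)

theorem step_bound (a : C(X, ℂ)) (b : ℂ) (hb : b ∈ (range a)ᶜ) :
    ∀ᶠ b' in 𝓝 b, (∀ x, ‖b' - b‖ ≤ 1/2 * ‖a x - b‖) ∧ (∀ x, ‖b - b'‖ ≤ 1/2 * ‖a x - b'‖) := by
  have hK : IsClosed (range a) := (isCompact_range a.continuous).isClosed
  obtain ⟨η, hη, hball⟩ := Metric.isOpen_iff.1 hK.isOpen_compl b hb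
  have h1 : ∀ x, η ≤ ‖a x - b‖ := by
    intro x
    by_contra h
    exact hball (show a x ∈ ball b η by rw [mem_ball, dist_eq_norm]; linarith) ⟨x, rfl⟩
  filter_upwards [Metric.ball_mem_nhds b (show 0 < η/3 by positivity)] with b' hb'
  rw [mem_ball, dist_eq_norm] at hb'
  constructor
  · intro x; linarith [h1 x]
  · intro x
    have h2 : ‖a x - b‖ ≤ ‖a x - b'‖ + ‖b' - b‖ := by
      have := norm_add_le (a x - b') (b' - b)
      simpa using this
    rw [norm_sub_rev]
    linarith [h1 x]

theorem inv_mem (S : Subalgebra ℂ C(X, ℂ)) (hS : IsClosed (S : Set C(X, ℂ)))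
    (a : C(X, ℂ)) (ha : a ∈ S) (hpre : IsPreconnected (range a)ᶜ) (b : ℂ) (hb : b ∈ (range a)ᶜ) :
    ∃ v ∈ S, ∀ x, v x * (a x - b) = 1 := by
  let P : ℂ → Prop := fun b => ∃ v ∈ S, ∀ x, v x * (a x - b) = 1
  have step : ∀ b b', (∀ x, ‖b' - b‖ ≤ 1/2 * ‖a x - b‖) → P b → P b' := by
    rintro b b' hbb ⟨v, hv, hv1⟩
    obtain ⟨w, hw, hw1⟩ := one_add_inv_mem S hS ((b - b') • v) (S.smul_mem hv _) (by
      intro x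
      have h1 : ‖v x‖ * ‖a x - b‖ = 1 := by rw [← norm_mul, hv1, norm_one]
      rw [ContinuousMap.smul_apply, norm_smul, norm_sub_rev]
      calc ‖b' - b‖ * ‖v x‖ ≤ 1/2 * ‖a x - b‖ * ‖v x‖ := by gcongr; exact hbb x
        _ = 1/2 * (‖v x‖ * ‖a x - b‖) := by ring
        _ = 1/2 := by rw [h1, mul_one])
    refine ⟨v * w, S.mul_mem hv hw, fun x => ?_⟩
    have h2 := hw1 x
    have h3 := hv1 x
    simp only [ContinuousMap.mul_apply, ContinuousMap.smul_apply, smul_eq_mul] at h2 ⊢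
    linear_combination h2 + (w x) * h3
  have far : ∀ b : ℂ, 2 * ‖a‖ + 1 ≤ ‖b‖ → P b := by
    intro b hb
    have hb1 : 0 < ‖b‖ := by linarith [norm_nonneg a]
    have hb0 : b ≠ 0 := norm_pos_iff.1 hb1
    obtain ⟨w, hw, hw1⟩ := one_add_inv_mem S hS ((-b⁻¹) • a) (S.smul_mem ha _) (by
      intro x
      rw [ContinuousMap.smul_apply, norm_smul, norm_neg, norm_inv, inv_mul_le_iff₀ hb1]
      have := a.norm_coe_le_norm x
      linarith)
    refine ⟨(-b⁻¹) • w, S.smul_mem hw _, fun x => ?_⟩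
    have h2 := hw1 x
    simp only [ContinuousMap.smul_apply, smul_eq_mul] at h2 ⊢
    rw [← h2]; field_simp; ring
  have hb2 : ((2 * ‖a‖ + 1 : ℝ) : ℂ) ∈ (range a)ᶜ := by
    rintro ⟨x, hx⟩
    have := a.norm_coe_le_norm x
    have h0 := norm_nonneg a
    rw [hx, Complex.norm_real, Real.norm_of_nonneg (by positivity)] at this
    linarith
  refine hpre.induction₂' (fun b b' => P b → P b') ?_ ?_ hb2 hb (far _ ?_)
  · intro x hx
    filter_upwards [nhdsWithin_le_nhds (step_bound a x hx)] with y hy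
    exact ⟨step _ _ hy.1, step _ _ hy.2⟩
  · intro x y z _ _ _ h1 h2 h3; exact h2 (h1 h3)
  · have h0 := norm_nonneg a
    rw [Complex.norm_real, Real.norm_of_nonneg (by positivity)]

theorem sqrt_near (g w : ℂ) (h : g ^ 2 = 1 + w) (hg : ‖g - 1‖ ≤ 9/16) : ‖g - 1‖ ≤ ‖w‖ := by
  have h2 : (g - 1) * (g + 1) = w := by linear_combination h
  have h3 : 1 ≤ ‖g + 1‖ := by
    have h4 : ‖(2:ℂ)‖ ≤ ‖g + 1‖ + ‖g - 1‖ := by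
      have := norm_sub_le (g + 1) (g - 1)
      rwa [show g + 1 - (g - 1) = 2 by ring] at this
    have : ‖(2:ℂ)‖ = 2 := by simp
    linarith
  calc ‖g - 1‖ ≤ ‖g - 1‖ * ‖g + 1‖ := le_mul_of_one_le_right (norm_nonneg _) h3
    _ = ‖w‖ := by rw [← norm_mul, h2]

theorem exists_sqrt_ratio (S : Subalgebra ℂ C(X, ℂ)) (hS : IsClosed (S : Set C(X, ℂ)))
    (a : C(X, ℂ)) (ha : a ∈ S) (hpre : IsPreconnected (range a)ᶜ)
    (c : ℂ) (δ : ℝ) (hδ : 0 < δ) (s : Set ℂ) (hs : IsPreconnected s)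
    (hs1 : s ⊆ (range a)ᶜ) (hs2 : s ⊆ closedBall c (2 * δ)) (p q : ℂ) (hp : p ∈ s) (hq : q ∈ s) :
    ∃ g ∈ S, (∀ x, g x ^ 2 * (a x - p) = a x - q) ∧
      ∀ x, 18 * δ ≤ ‖a x - c‖ → ‖g x - 1‖ ≤ 1/4 := by
  have hne : ∀ b ∈ s, ∀ x, a x - b ≠ 0 := fun b hb x hx => hs1 hb ⟨x, sub_eq_zero.1 hx⟩
  have hfar : ∀ b ∈ s, ∀ b' ∈ s, ∀ x, 18 * δ ≤ ‖a x - c‖ → ‖(b - b') / (a x - b)‖ ≤ 1/4 := by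
    intro b hb b' hb' x hx
    have h1 := hs2 hb
    have h2 := hs2 hb'
    rw [mem_closedBall, dist_eq_norm] at h1 h2
    have h3 : ‖b - b'‖ ≤ ‖b - c‖ + ‖b' - c‖ := by
      have := norm_sub_le (b - c) (b' - c)
      simpa using this
    have h4 : ‖a x - c‖ ≤ ‖a x - b‖ + ‖b - c‖ := by
      have := norm_add_le (a x - b) (b - c)
      simpa using this
    rw [norm_div, div_le_iff₀ (norm_pos_iff.2 (hne b hb x))]
    linarith
  obtain ⟨F, hF, hFsq, hF1⟩ := exists_sqrt
  have step : ∀ b ∈ s, ∀ b' ∈ s, (∀ x, ‖b' - b‖ ≤ 1/2 * ‖a x - b‖) →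
      ∃ g ∈ S, (∀ x, g x ^ 2 * (a x - b) = a x - b') ∧
      ∀ x, 18 * δ ≤ ‖a x - c‖ → ‖g x - 1‖ ≤ 1/4 := by
    intro b hb b' hb' hbb
    obtain ⟨v, hv, hv1⟩ := inv_mem S hS a ha hpre b (hs1 hb)
    have hux : ∀ x, ((b - b') • v) x = (b - b') / (a x - b) := by
      intro x
      rw [ContinuousMap.smul_apply, smul_eq_mul, eq_div_iff (hne b hb x), mul_assoc, hv1, mul_one]
    have hu2 : ∀ x, ‖((b - b') • v) x‖ ≤ 1/2 := by
      intro x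
      rw [hux, norm_div, div_le_iff₀ (norm_pos_iff.2 (hne b hb x)), norm_sub_rev]
      exact hbb x
    set u := (b - b') • v
    have hu1 : ∀ x, ‖u x‖ < 1 := fun x => lt_of_le_of_lt (hu2 x) (by norm_num)
    let g : C(X, ℂ) := ⟨fun x => F (u x), hF.continuousOn.comp_continuous u.continuous
      (fun x => by simpa using hu1 x)⟩
    refine ⟨g, analytic_comp S hS F hF u g (S.smul_mem hv _) hu2 (fun x => rfl), fun x => ?_,
      fun x hx => ?_⟩
    · change F (u x) ^ 2 * (a x - b) = a x - b'
      have := hne b hb x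
      rw [hFsq _ (hu1 x), hux]
      field_simp
      ring
    · refine (hF1 _ (hu1 x)).trans ?_
      rw [hux]
      exact hfar b hb b' hb' x hx
  refine hs.induction₂' (fun p q => ∃ g ∈ S, (∀ x, g x ^ 2 * (a x - p) = a x - q) ∧
      ∀ x, 18 * δ ≤ ‖a x - c‖ → ‖g x - 1‖ ≤ 1/4) ?_ ?_ hp hq
  · intro x hx
    filter_upwards [nhdsWithin_le_nhds (step_bound a x (hs1 hx)), self_mem_nhdsWithin] with y hy hys
    exact ⟨step _ hx _ hys hy.1, step _ hys _ hx hy.2⟩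
  · rintro b b' b'' hb hb' hb'' ⟨g, hg, hg1, hg2⟩ ⟨k, hk, hk1, hk2⟩
    have hsq : ∀ x, (g * k) x ^ 2 * (a x - b) = a x - b'' := by
      intro x
      rw [← hk1, ← hg1, ContinuousMap.mul_apply]; ring
    refine ⟨g * k, S.mul_mem hg hk, hsq, fun x hx => ?_⟩
    refine (sqrt_near ((g * k) x) ((b - b'') / (a x - b)) ?_ ?_).trans (hfar b hb b'' hb'' x hx)
    · have := hne b hb x
      have h1 := hsq x
      field_simp
      linear_combination h1
    · have h1 := hg2 x hx
      have h2 := hk2 x hx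
      have h3 : (g * k) x - 1 = (g x - 1) * (k x - 1) + (g x - 1) + (k x - 1) := by
        rw [ContinuousMap.mul_apply]; ring
      rw [h3]
      have h4 : ‖g x - 1‖ * ‖k x - 1‖ ≤ 1/4 * (1/4) := by gcongr
      calc _ ≤ ‖(g x - 1) * (k x - 1)‖ + ‖g x - 1‖ + ‖k x - 1‖ := norm_add₃_le
        _ ≤ 9/16 := by rw [norm_mul]; linarith

theorem exists_arc (K : Set ℂ) (hK : IsCompact K) (hpre : IsPreconnected Kᶜ) (c p : ℂ) (δ : ℝ)
    (hδ : 0 < δ) (hp : p ∈ Kᶜ) (hpc : ‖p - c‖ < δ) :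
    ∃ s : Set ℂ, IsPreconnected s ∧ s ⊆ Kᶜ ∧ s ⊆ closedBall c (2 * δ) ∧ p ∈ s ∧
      ∃ q ∈ s, ‖q - c‖ = 2 * δ := by
  obtain ⟨R, hR⟩ := hK.isBounded.exists_norm_le
  obtain ⟨e, he, hec⟩ : ∃ e ∈ Kᶜ, 2 * δ ≤ ‖e - c‖ := by
    let r : ℝ := |R| + 2 * δ + ‖c‖ + 1
    have hr : 0 < r := by positivity
    have hr1 : ‖(r : ℂ)‖ = r := by rw [Complex.norm_real, Real.norm_of_nonneg hr.le]
    refine ⟨r, fun h => ?_, ?_⟩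
    · have := hR _ h
      rw [hr1] at this
      have h2 := le_abs_self R
      have h3 := norm_nonneg c
      simp only [r] at this; linarith
    · have := norm_sub_norm_le (r : ℂ) c
      rw [hr1] at this
      have h2 := abs_nonneg R
      simp only [r] at this ⊢; linarith
  have hpath : IsPathConnected Kᶜ :=
    (hK.isClosed.isOpen_compl.isConnected_iff_isPathConnected).1 ⟨⟨p, hp⟩, hpre⟩
  obtain ⟨γ, hγ⟩ := hpath.joinedIn p hp e he
  let f : ℝ → ℝ := fun t => ‖γ.extend t - c‖
  have hγc : Continuous γ.extend := γ.continuous_extend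
  have hf : Continuous f := by fun_prop
  have hγK : ∀ t, γ.extend t ∈ Kᶜ := fun t => by
    have : γ.extend t ∈ range γ := by rw [← γ.extend_range]; exact ⟨t, rfl⟩
    obtain ⟨t', ht'⟩ := this
    rw [← ht']; exact hγ t'
  have hT : IsCompact (Icc (0:ℝ) 1 ∩ {t | 2 * δ ≤ f t}) :=
    isCompact_Icc.inter_right (isClosed_le continuous_const hf)
  obtain ⟨t1, ⟨ht1, ht1'⟩, hleast⟩ := hT.exists_isLeast
    ⟨1, ⟨by norm_num, by norm_num⟩, by simpa [f] using hec⟩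
  have hf0 : f 0 < δ := by simpa [f] using hpc
  obtain ⟨t2, ht2, ht2'⟩ := intermediate_value_Icc ht1.1 hf.continuousOn
    (show 2 * δ ∈ _ from ⟨by linarith, ht1'⟩)
  have heq : t1 = t2 :=
    le_antisymm (hleast ⟨⟨ht2.1, ht2.2.trans ht1.2⟩, ht2'.ge⟩) ht2.2
  subst heq
  refine ⟨γ.extend '' Icc 0 t1, isPreconnected_Icc.image _ hγc.continuousOn, ?_, ?_,
    ⟨0, ⟨le_rfl, ht1.1⟩, by simp⟩, γ.extend t1, ⟨t1, ⟨ht1.1, le_rfl⟩, rfl⟩, ht2'⟩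
  · rintro _ ⟨t, -, rfl⟩; exact hγK t
  · rintro _ ⟨t, ht, rfl⟩
    rw [mem_closedBall, dist_eq_norm]
    by_contra hlt
    push Not at hlt
    have := hleast ⟨⟨ht.1, ht.2.trans ht1.2⟩, hlt.le⟩
    have : t = t1 := le_antisymm ht.2 this
    subst this
    exact absurd ht2' hlt.ne'

theorem kernel (S : Subalgebra ℂ C(X, ℂ)) (hS : IsClosed (S : Set C(X, ℂ)))
    (a : C(X, ℂ)) (ha : a ∈ S) (hpre : IsPreconnected (range a)ᶜ)
    (hint : interior (range a) = ∅) (c : ℂ) (δ : ℝ) (hδ : 0 < δ) :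
    ∃ Q ∈ S, ∀ x, ∀ ζ, ‖ζ - c‖ ≤ δ → a x ≠ ζ →
      ‖Q x - (a x - ζ)⁻¹‖ ≤ 30405 * √δ / (‖a x - ζ‖ * √‖a x - ζ‖) := by
  have hK := isCompact_range a.continuous
  obtain ⟨p, hp, hpc⟩ : ∃ p ∈ (range a)ᶜ, ‖p - c‖ < δ := by
    have : Dense (range a)ᶜ := interior_eq_empty_iff_dense_compl.1 hint
    obtain ⟨p, hp, hpc⟩ := Metric.dense_iff.1 this c δ hδ
    exact ⟨p, hpc, by simpa [dist_eq_norm] using hp⟩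
  obtain ⟨s, hs, hs1, hs2, hps, q, hqs, hqc⟩ := exists_arc _ hK hpre c p δ hδ hp hpc
  obtain ⟨g, hg, hg1, hg2⟩ := exists_sqrt_ratio S hS a ha hpre c δ hδ s hs hs1 hs2 p q hps hqs
  have hqp : δ ≤ ‖q - p‖ := by
    have := norm_add_le (q - p) (p - c)
    rw [sub_add_sub_cancel] at this
    linarith
  have hqp0 : q - p ≠ 0 := norm_pos_iff.1 (by linarith)
  let m : ℂ := (p + q) / 2
  let h : C(X, ℂ) := a - algebraMap ℂ _ m - (a - algebraMap ℂ _ p) * g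
  have hh : h ∈ S := S.sub_mem (S.sub_mem ha (S.algebraMap_mem _))
    (S.mul_mem (S.sub_mem ha (S.algebraMap_mem _)) hg)
  have hhx : ∀ x, h x = a x - m - (a x - p) * g x := fun x => by simp [h]
  refine ⟨(8 / (q - p) ^ 2) • h, S.smul_mem hh _, fun x ζ hζ hne => ?_⟩
  set z := a x
  have hzp : z - p ≠ 0 := fun hx => hp ⟨x, sub_eq_zero.1 hx⟩
  set w := ‖z - ζ‖ with hw
  have hw0 : 0 < w := norm_pos_iff.2 (sub_ne_zero.2 hne)
  have hzc1 : ‖z - c‖ ≤ w + δ := by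
    have := norm_add_le (z - ζ) (ζ - c)
    rw [sub_add_sub_cancel] at this
    linarith
  have hzc2 : w ≤ ‖z - c‖ + δ := by
    have := norm_sub_le (z - c) (ζ - c)
    rw [sub_sub_sub_cancel_right] at this
    linarith
  have hmc : ‖m - c‖ ≤ 2 * δ := by
    have : m - c = ((p - c) + (q - c)) / 2 := by simp only [m]; ring
    rw [this, norm_div]
    have h1 := norm_add_le (p - c) (q - c)
    have : ‖(2:ℂ)‖ = 2 := by simp
    rw [this]
    linarith
  have hQx : ((8 / (q - p) ^ 2) • h) x = 8 / (q - p) ^ 2 * (z - m - (z - p) * g x) := by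
    rw [ContinuousMap.smul_apply, hhx, smul_eq_mul]
  rw [hQx]
  have hsqw : 0 < √w := Real.sqrt_pos.2 hw0
  have hww : √w * √w = w := Real.mul_self_sqrt hw0.le
  have hdd : √δ * √δ = δ := Real.mul_self_sqrt hδ.le
  rcases lt_or_ge ‖z - c‖ (18 * δ) with hnear | hfar
  · have h1 : ‖z - m‖ ≤ 20 * δ := by
      have := norm_sub_le (z - c) (m - c)
      rw [sub_sub_sub_cancel_right] at this
      linarith
    have h2 : ‖z - p‖ ≤ 20 * δ := by
      have := norm_sub_le (z - c) (p - c)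
      rw [sub_sub_sub_cancel_right] at this
      linarith
    have h3 : ‖z - q‖ ≤ 20 * δ := by
      have := norm_sub_le (z - c) (q - c)
      rw [sub_sub_sub_cancel_right] at this
      linarith
    have h4 : ‖(z - p) * g x‖ ≤ 20 * δ := by
      have h5 : ‖(z - p) * g x‖ ^ 2 ≤ (20 * δ) ^ 2 := by
        have : ((z - p) * g x) ^ 2 = (z - p) * (z - q) := by
          rw [← hg1 x]; ring
        rw [← norm_pow, this, norm_mul, sq]
        gcongr
      exact (sq_le_sq₀ (norm_nonneg _) (by positivity)).1 h5
    have h5 : ‖8 / (q - p) ^ 2 * (z - m - (z - p) * g x)‖ ≤ 320 / δ := by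
      rw [norm_mul, norm_div, norm_pow]
      have h8 : ‖(8:ℂ)‖ = 8 := by simp
      rw [h8]
      calc 8 / ‖q - p‖ ^ 2 * ‖z - m - (z - p) * g x‖ ≤ 8 / δ ^ 2 * (40 * δ) := by
            gcongr
            have := norm_sub_le (z - m) ((z - p) * g x)
            linarith
        _ = 320 / δ := by field_simp; norm_num
    have h6 : w ≤ 19 * δ := by linarith
    have h7 : ‖8 / (q - p) ^ 2 * (z - m - (z - p) * g x) - (z - ζ)⁻¹‖ ≤ 6081 / w := by
      refine (norm_sub_le _ _).trans ?_
      rw [norm_inv, ← hw]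
      have : 320 / δ ≤ 6080 / w := by
        rw [div_le_div_iff₀ hδ hw0]; linarith
      calc _ ≤ 6080 / w + w⁻¹ := by linarith
        _ = 6081 / w := by rw [inv_eq_one_div, ← add_div]; norm_num
    refine h7.trans ?_
    rw [div_le_div_iff₀ hw0 (by positivity)]
    have h8 : √w ≤ 5 * √δ := by
      rw [show 5 * √δ = √(25 * δ) by
        rw [Real.sqrt_mul (by norm_num), show (25:ℝ) = 5 ^ 2 by norm_num, Real.sqrt_sq (by norm_num)]]
      exact Real.sqrt_le_sqrt (by linarith)
    nlinarith
  · have hw17 : 17 * δ ≤ w := by linarith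
    have hgx := hg2 x hfar
    have hzp1 : w / 2 ≤ ‖z - p‖ := by
      have := norm_add_le (z - p) (p - c)
      rw [sub_add_sub_cancel] at this
      linarith
    have hpq : ‖q - p‖ ≤ 4 * δ := by
      have := norm_sub_le (q - c) (p - c)
      rw [sub_sub_sub_cancel_right] at this
      linarith
    have hg3 : ‖g x - 1‖ ≤ ‖(p - q) / (z - p)‖ := by
      refine sqrt_near _ _ ?_ (hgx.trans (by norm_num))
      have h1 : g x ^ 2 * (z - p) = z - q := hg1 x
      field_simp
      linear_combination h1
    have hg4 : ‖(z - p) * (1 - g x)‖ ≤ 4 * δ := by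
      rw [norm_mul, norm_sub_rev 1]
      rw [norm_div, norm_sub_rev p q, le_div_iff₀ (norm_pos_iff.2 hzp)] at hg3
      linarith
    let D : ℂ := z - m + (z - p) * g x
    have hD : D = 2 * (z - p) - ((z - p) * (1 - g x)) - (q - p) / 2 := by
      simp only [D, m]; ring
    have hDn : w / 2 ≤ ‖D‖ := by
      have h1 : ‖2 * (z - p)‖ ≤ ‖D‖ + ‖(z - p) * (1 - g x)‖ + ‖(q - p) / 2‖ := by
        have : 2 * (z - p) = D + (z - p) * (1 - g x) + (q - p) / 2 := by rw [hD]; ring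
        rw [this]
        exact norm_add₃_le
      have h2 : ‖(2:ℂ)‖ = 2 := by simp
      rw [norm_mul, norm_div, h2] at h1
      linarith
    have hD0 : D ≠ 0 := norm_pos_iff.1 (by linarith)
    have hQD : 8 / (q - p) ^ 2 * (z - m - (z - p) * g x) = 2 / D := by
      rw [eq_div_iff hD0]
      have h1 : g x ^ 2 * (z - p) = z - q := hg1 x
      field_simp
      simp only [D, m]
      linear_combination (-8 * (z - p)) * h1
    rw [hQD]
    have hzζ : z - ζ ≠ 0 := sub_ne_zero.2 hne
    have hdiff : 2 / D - (z - ζ)⁻¹ =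
        ((z - p) * (1 - g x) + (p - ζ) + (m - ζ)) / (D * (z - ζ)) := by
      field_simp
      simp only [D]; ring
    have hnum : ‖(z - p) * (1 - g x) + (p - ζ) + (m - ζ)‖ ≤ 10 * δ := by
      refine norm_add₃_le.trans ?_
      have h1 := norm_sub_le (p - c) (ζ - c)
      have h2 := norm_sub_le (m - c) (ζ - c)
      rw [sub_sub_sub_cancel_right] at h1 h2
      linarith
    rw [hdiff, norm_div, norm_mul, ← hw]
    calc _ ≤ 10 * δ / (w / 2 * w) := by gcongr
      _ ≤ 30405 * √δ / (w * √w) := by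
        rw [div_le_div_iff₀ (by positivity) (by positivity)]
        have h8 : √δ ≤ √w := Real.sqrt_le_sqrt (by linarith)
        have h9 : δ * √w ≤ √δ * w := by
          calc δ * √w = √δ * (√δ * √w) := by rw [← mul_assoc, hdd]
            _ ≤ √δ * (√w * √w) := by gcongr
            _ = √δ * w := by rw [hww]
        have : 0 ≤ √δ * w := by positivity
        nlinarith

end


section integral
open MeasureTheory

theorem circleAverage_inv_lt (z : ℂ) (r : ℝ) (hr : 0 < r) (h : r < ‖z‖) :
    Real.circleAverage (fun ζ => (z - ζ)⁻¹) 0 r = z⁻¹ := by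
  have hd : DiffContOnCl ℂ (fun ζ => (z - ζ)⁻¹) (ball 0 |r|) := by
    refine DifferentiableOn.diffContOnCl ?_
    intro ζ hζ
    have hζ' := closure_ball_subset_closedBall hζ
    rw [mem_closedBall_zero_iff, abs_of_pos hr] at hζ'
    have hne : z - ζ ≠ 0 := by
      intro h0
      rw [sub_eq_zero.1 h0] at h; linarith
    exact (DifferentiableAt.inv (by fun_prop) hne).differentiableWithinAt
  rw [hd.circleAverage]; simp

theorem circleAverage_inv_gt (z : ℂ) (r : ℝ) (hr : 0 < r) (h : ‖z‖ < r) :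
    Real.circleAverage (fun ζ => (z - ζ)⁻¹) 0 r = 0 := by
  rw [Real.circleAverage_eq_circleIntegral hr.ne']
  have hzero : (∮ ζ in C(0, r), (ζ - 0)⁻¹ • (z - ζ)⁻¹) = 0 := by
    by_cases hz : z = 0
    · subst hz
      have := circleIntegral.integral_sub_zpow_of_ne (n := -2) (by norm_num) 0 0 r
      have h2 : ∀ ζ : ℂ, (ζ - 0)⁻¹ • (0 - ζ)⁻¹ = (-1 : ℂ) • (ζ - 0) ^ (-2 : ℤ) := by
        intro ζ
        by_cases h0 : ζ = 0
        · simp [h0]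
        · rw [show (ζ - 0) ^ (-2 : ℤ) = ((ζ - 0) ^ 2)⁻¹ from _root_.zpow_neg _ 2]
          simp only [smul_eq_mul, sub_zero, zero_sub]
          field_simp
      simp_rw [h2]
      rw [circleIntegral.integral_smul, this, smul_zero]
    · have h1 : (∮ ζ in C(0, r), (ζ - 0)⁻¹) = 2 * Real.pi * Complex.I :=
        circleIntegral.integral_sub_inv_of_mem_ball (by simpa using hr)
      have h2 : (∮ ζ in C(0, r), (ζ - z)⁻¹) = 2 * Real.pi * Complex.I :=
        circleIntegral.integral_sub_inv_of_mem_ball (by simpa using h)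
      have i1 : CircleIntegrable (fun ζ : ℂ => (ζ - 0)⁻¹) 0 r := by
        refine circleIntegrable_sub_inv_iff.2 (Or.inr ?_)
        simp [abs_of_pos hr, hr.ne]
      have i2 : CircleIntegrable (fun ζ : ℂ => (ζ - z)⁻¹) 0 r := by
        refine circleIntegrable_sub_inv_iff.2 (Or.inr ?_)
        simp [abs_of_pos hr, h.ne]
      have h3 : (∮ ζ in C(0, r), (ζ - 0)⁻¹ • (z - ζ)⁻¹) =
          ∮ ζ in C(0, r), z⁻¹ • ((ζ - 0)⁻¹ - (ζ - z)⁻¹) := by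
        refine circleIntegral.integral_congr hr.le fun ζ hζ => ?_
        rw [mem_sphere_zero_iff_norm] at hζ
        have h4 : ζ ≠ 0 := by rintro rfl; simp at hζ; linarith
        have h5 : ζ - z ≠ 0 := by intro h0; rw [sub_eq_zero.1 h0] at hζ; linarith
        have h6 : z - ζ ≠ 0 := by rwa [← neg_ne_zero, neg_sub]
        simp only [smul_eq_mul, sub_zero]
        field_simp
        ring
      rw [h3, circleIntegral.integral_smul, circleIntegral.integral_sub i1 i2, h1, h2, sub_self,
        smul_zero]
  rw [hzero, smul_zero]

theorem angle_integral (f : ℂ → ℂ) (r : ℝ) :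
    ∫ θ in Ioo (-Real.pi) Real.pi, f (Complex.polarCoord.symm (r, θ)) =
      (2 * Real.pi) • Real.circleAverage f 0 r := by
  have hpi := Real.pi_pos
  rw [← integral_Ioc_eq_integral_Ioo, ← intervalIntegral.integral_of_le (by linarith),
    Real.circleAverage_eq_integral_add (-Real.pi), smul_smul,
    mul_inv_cancel₀ (by positivity), one_smul,
    intervalIntegral.integral_comp_add_right (fun θ => f (circleMap 0 r θ))]
  rw [show 0 + -Real.pi = -Real.pi by ring, show 2 * Real.pi + -Real.pi = Real.pi by ring]
  refine intervalIntegral.integral_congr fun θ _ => ?_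
  simp only [Complex.polarCoord_symm_apply, circleMap, zero_add, Complex.exp_mul_I]
  push_cast
  rfl

theorem integrableOn_ker (r : ℝ) :
    IntegrableOn (fun w : ℂ => (‖w‖ * √‖w‖)⁻¹) (ball 0 r) := by
  rw [integrableOn_fun_norm_addHaar volume (f := fun y => (y * √y)⁻¹)]
  rcases le_or_gt r 0 with hr | hr
  · simp [Ioo_eq_empty_of_le hr]
  have h1 := intervalIntegral.intervalIntegrable_rpow' (a := 0) (b := r) (r := -(1/2))
    (by norm_num)
  rw [intervalIntegrable_iff_integrableOn_Ioo_of_le hr.le] at h1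
  refine h1.congr_fun (fun y hy => ?_) measurableSet_Ioo
  have hy0 : 0 < y := hy.1
  simp only [Complex.finrank_real_complex, smul_eq_mul]
  rw [Real.rpow_neg hy0.le, ← Real.sqrt_eq_rpow]
  have := Real.sqrt_pos.2 hy0
  rw [show 2 - 1 = 1 from rfl, pow_one]
  field_simp

theorem integrableOn_ker_shift (z : ℂ) (R : ℝ) (hz : ‖z‖ < R) :
    IntegrableOn (fun ζ : ℂ => (‖z - ζ‖ * √‖z - ζ‖)⁻¹) (ball 0 R) ∧
    ∫ ζ in ball 0 R, (‖z - ζ‖ * √‖z - ζ‖)⁻¹ ≤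
      ∫ w in ball (0:ℂ) (2 * R), (‖w‖ * √‖w‖)⁻¹ := by
  have h1 := (integrableOn_ker (2 * R)).integrable_indicator measurableSet_ball
  have h2 := h1.comp_sub_left z
  have h3 : EqOn (fun ζ => (ball (0:ℂ) (2 * R)).indicator (fun w : ℂ => (‖w‖ * √‖w‖)⁻¹) (z - ζ))
      (fun ζ => (‖z - ζ‖ * √‖z - ζ‖)⁻¹) (ball 0 R) := by
    intro ζ hζ
    rw [mem_ball_zero_iff] at hζ
    have : z - ζ ∈ ball (0:ℂ) (2 * R) := by
      rw [mem_ball_zero_iff]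
      have := norm_sub_le z ζ
      linarith
    simp only [indicator_of_mem this]
  refine ⟨h2.integrableOn.congr_fun h3 measurableSet_ball, ?_⟩
  rw [← setIntegral_congr_fun measurableSet_ball h3,
    ← integral_indicator (s := ball (0:ℂ) (2 * R)) measurableSet_ball,
    ← integral_sub_left_eq_self ((ball (0:ℂ) (2 * R)).indicator _) volume z]
  refine setIntegral_le_integral h2 (Eventually.of_forall fun ζ => ?_)
  exact indicator_nonneg (fun w _ => by positivity) _

theorem integrableOn_cauchy (z : ℂ) (R : ℝ) (hz : ‖z‖ < R) :
    IntegrableOn (fun ζ : ℂ => (z - ζ)⁻¹) (ball 0 R) := by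
  refine Integrable.mono' ((integrableOn_ker_shift z R hz).1.const_mul √(2 * R)) ?_ ?_
  · exact Measurable.aestronglyMeasurable (by fun_prop)
  · refine (ae_restrict_iff' measurableSet_ball).2 (Eventually.of_forall fun ζ hζ => ?_)
    rw [mem_ball_zero_iff] at hζ
    have h1 : ‖z - ζ‖ ≤ 2 * R := by
      have := norm_sub_le z ζ
      linarith
    rcases (norm_nonneg (z - ζ)).eq_or_lt with h0 | h0
    · rw [norm_inv, ← h0]; simp
    · have h2 := Real.sqrt_le_sqrt h1
      have h3 := Real.sqrt_pos.2 h0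
      rw [norm_inv, mul_inv, mul_comm, mul_assoc]
      refine le_mul_of_one_le_right (by positivity) ?_
      rw [inv_mul_eq_div, le_div_iff₀ h3]
      linarith

theorem cauchy_area (z : ℂ) (R : ℝ) (hz : ‖z‖ < R) :
    ∫ ζ in ball 0 R, (z - ζ)⁻¹ = Real.pi * (starRingEnd ℂ) z := by
  have hR : 0 < R := (norm_nonneg z).trans_lt hz
  set f : ℂ → ℂ := (ball (0:ℂ) R).indicator (fun ζ => (z - ζ)⁻¹) with hf
  have hfi : Integrable f := (integrableOn_cauchy z R hz).integrable_indicator measurableSet_ball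
  have hfm : Measurable f := Measurable.indicator (by fun_prop) measurableSet_ball
  rw [← integral_indicator measurableSet_ball, ← hf, ← Complex.integral_comp_polarCoord_symm]
  have hsm : Measurable (fun p : ℝ × ℝ => Complex.polarCoord.symm p) := by
    simp only [Complex.polarCoord_symm_apply]
    fun_prop
  have hint : IntegrableOn (fun p : ℝ × ℝ => p.1 • f (Complex.polarCoord.symm p))
      (Ioi (0:ℝ) ×ˢ Ioo (-Real.pi) Real.pi) := by
    refine ⟨(Measurable.aestronglyMeasurable
      (measurable_fst.smul (hfm.comp hsm))), ?_⟩
    have h1 := Complex.lintegral_comp_polarCoord_symm (fun ζ => ‖f ζ‖ₑ)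
    have h2 := hfi.2
    rw [HasFiniteIntegral, ← h1] at h2
    rw [HasFiniteIntegral]
    refine lt_of_eq_of_lt ?_ h2
    refine setLIntegral_congr_fun (measurableSet_Ioi.prod measurableSet_Ioo) fun p hp => ?_
    have hp1 : 0 < p.1 := hp.1
    simp only [enorm_smul, smul_eq_mul]
    rw [Real.enorm_of_nonneg hp1.le]
  rw [polarCoord_target, Measure.volume_eq_prod, setIntegral_prod _ (by
    rwa [← Measure.volume_eq_prod])]
  simp_rw [integral_smul, angle_integral]
  have hinner : ∀ r ∈ Ioi (0:ℝ), r ≠ ‖z‖ → r • (2 * Real.pi) • Real.circleAverage f 0 r =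
      (Ioo 0 ‖z‖).indicator (fun r : ℝ => ((r : ℝ) : ℂ) * (2 * Real.pi * z⁻¹)) r := by
    intro r hr hrz
    have hr0 : 0 < r := hr
    rcases lt_or_gt_of_ne hrz with h | h
    · rw [indicator_of_mem (show r ∈ Ioo 0 ‖z‖ from ⟨hr0, h⟩)]
      have : Real.circleAverage f 0 r = Real.circleAverage (fun ζ => (z - ζ)⁻¹) 0 r := by
        refine Real.circleAverage_congr_sphere fun ζ hζ => ?_
        rw [mem_sphere_zero_iff_norm, abs_of_pos hr0] at hζ
        exact indicator_of_mem (by rw [mem_ball_zero_iff]; linarith) _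
      rw [this, circleAverage_inv_lt z r hr0 h]
      simp only [Complex.real_smul]; push_cast; ring
    · rw [indicator_of_notMem (fun h' => lt_asymm h h'.2)]
      rcases lt_or_ge r R with hrR | hrR
      · have : Real.circleAverage f 0 r = Real.circleAverage (fun ζ => (z - ζ)⁻¹) 0 r := by
          refine Real.circleAverage_congr_sphere fun ζ hζ => ?_
          rw [mem_sphere_zero_iff_norm, abs_of_pos hr0] at hζ
          exact indicator_of_mem (by rw [mem_ball_zero_iff]; linarith) _
        rw [this, circleAverage_inv_gt z r hr0 h]; simp
      · have : Real.circleAverage f 0 r = Real.circleAverage (fun ζ => (0:ℂ)) 0 r := by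
          refine Real.circleAverage_congr_sphere fun ζ hζ => ?_
          rw [mem_sphere_zero_iff_norm, abs_of_pos hr0] at hζ
          exact indicator_of_notMem (by rw [mem_ball_zero_iff]; linarith) _
        rw [this]; simp [Real.circleAverage]
  have hae : ∫ r in Ioi (0:ℝ), r • (2 * Real.pi) • Real.circleAverage f 0 r =
      ∫ r in Ioi (0:ℝ),
        (Ioo 0 ‖z‖).indicator (fun r : ℝ => ((r : ℝ) : ℂ) * (2 * Real.pi * z⁻¹)) r := by
    refine setIntegral_congr_ae measurableSet_Ioi ?_
    have : ∀ᵐ r : ℝ, r ≠ ‖z‖ := by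
      simp [ae_iff, measure_singleton]
    filter_upwards [this] with r hr hr0
    exact hinner r hr0 hr
  rw [hae, setIntegral_indicator measurableSet_Ioo,
    inter_eq_self_of_subset_right Ioo_subset_Ioi_self, ← integral_Ioc_eq_integral_Ioo,
    ← intervalIntegral.integral_of_le (norm_nonneg z), intervalIntegral.integral_mul_const,
    intervalIntegral.integral_ofReal, integral_id]
  by_cases hz0 : z = 0
  · simp [hz0]
  · have h1 : z * (starRingEnd ℂ) z = (‖z‖ : ℂ) ^ 2 := Complex.mul_conj' z
    push_cast
    field_simp
    linear_combination (-1 : ℂ) * h1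
end integral



theorem aeval_cm_apply {X : Type*} [TopologicalSpace X] (a : C(X, ℂ)) (p : ℂ[X]) (x : X) :
    (aeval a p) x = p.eval (a x) := by
  rw [← Polynomial.coe_aeval_eq_eval]
  exact (Polynomial.aeval_algHom_apply (ContinuousMap.evalAlgHom ℂ ℂ x) a p).symm

section lavrentiev
open MeasureTheory

theorem exists_simple (R δ : ℝ) (hδ : 0 < δ) :
    ∃ q : SimpleFunc ℂ ℂ, ∀ ζ ∈ ball (0:ℂ) R, ‖ζ - q ζ‖ ≤ δ := by
  let e := TopologicalSpace.denseSeq ℂ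
  obtain ⟨t, ht⟩ := (isCompact_closedBall (0:ℂ) R).elim_finite_subcover
    (fun k => ball (e k) δ) (fun k => isOpen_ball) (fun z _ => by
      obtain ⟨k, hk⟩ := (TopologicalSpace.denseRange_denseSeq ℂ).exists_dist_lt z hδ
      exact mem_iUnion.2 ⟨k, hk⟩)
  refine ⟨SimpleFunc.nearestPt e (t.sup id), fun ζ hζ => ?_⟩
  obtain ⟨k, hk⟩ := mem_iUnion.1 (ht (ball_subset_closedBall hζ))
  obtain ⟨hkt, hk⟩ := mem_iUnion.1 hk
  have h1 := SimpleFunc.edist_nearestPt_le e ζ (Finset.le_sup (f := id) hkt)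
  have h2 : dist (SimpleFunc.nearestPt e (t.sup id) ζ) ζ ≤ dist (e k) ζ := by
    rw [edist_dist, edist_dist] at h1
    exact (ENNReal.ofReal_le_ofReal_iff dist_nonneg).1 h1
  rw [← dist_eq_norm, dist_comm]
  rw [mem_ball, dist_comm] at hk
  exact h2.trans hk.le

variable {X : Type*} [TopologicalSpace X] [CompactSpace X]

theorem conj_mem (S : Subalgebra ℂ C(X, ℂ)) (hS : IsClosed (S : Set C(X, ℂ)))
    (a : C(X, ℂ)) (ha : a ∈ S) (hpre : IsPreconnected (range a)ᶜ)
    (hint : interior (range a) = ∅) : star a ∈ S := by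
  let R : ℝ := ‖a‖ + 1
  have haR : ∀ x, ‖a x‖ < R := fun x => by
    have := a.norm_coe_le_norm x
    simp only [R]; linarith
  let I : ℝ := ∫ w in ball (0:ℂ) (2 * R), (‖w‖ * √‖w‖)⁻¹
  have hI : 0 ≤ I := integral_nonneg fun w => by positivity
  have approx : ∀ δ : ℝ, 0 < δ → ∃ G ∈ S, ∀ x, ‖G x - Real.pi * star (a x)‖ ≤
      30405 * √δ * I := by
    intro δ hδ
    obtain ⟨q, hq⟩ := exists_simple R δ hδ
    choose Q hQS hQ using fun c => kernel S hS a ha hpre hint c δ hδ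
    let μ : Measure ℂ := volume.restrict (ball (0:ℂ) R)
    have : IsFiniteMeasure μ := ⟨by
      rw [Measure.restrict_apply_univ]; exact measure_ball_lt_top⟩
    let φ : SimpleFunc ℂ C(X, ℂ) := q.map Q
    have hφ : Integrable φ μ := SimpleFunc.integrable_of_isFiniteMeasure φ
    refine ⟨∫ ζ, φ ζ ∂μ, ?_, fun x => ?_⟩
    · rw [← SimpleFunc.integral_eq_integral _ hφ, SimpleFunc.integral_eq]
      refine S.sum_mem fun f hf => ?_
      obtain ⟨ζ, rfl⟩ := SimpleFunc.mem_range.1 hf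
      rw [RCLike.real_smul_eq_coe_smul (K := ℂ)]
      exact S.smul_mem (hQS _) _
    · rw [ContinuousMap.integral_apply hφ]
      have hφx : Integrable (fun ζ => φ ζ x) μ :=
        (ContinuousMap.evalCLM ℂ x : C(X, ℂ) →L[ℂ] ℂ).integrable_comp hφ
      have h1 := cauchy_area (a x) R (haR x)
      have h2 : IntegrableOn (fun ζ : ℂ => (a x - ζ)⁻¹) (ball 0 R) :=
        integrableOn_cauchy (a x) R (haR x)
      obtain ⟨h3, h4⟩ := integrableOn_ker_shift (a x) R (haR x)
      rw [show star (a x) = (starRingEnd ℂ) (a x) from rfl, ← h1, ← integral_sub hφx h2]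
      calc ‖∫ ζ in ball 0 R, (φ ζ x - (a x - ζ)⁻¹)‖
          ≤ ∫ ζ in ball 0 R, 30405 * √δ * (‖a x - ζ‖ * √‖a x - ζ‖)⁻¹ := by
            refine norm_integral_le_of_norm_le (h3.const_mul _) ?_
            refine (ae_restrict_iff' measurableSet_ball).2 ?_
            have : ∀ᵐ ζ : ℂ, ζ ≠ a x := by simp [ae_iff, measure_singleton]
            filter_upwards [this] with ζ hζ hζB
            have := hQ (q ζ) x ζ (hq ζ hζB) hζ.symm
            rwa [div_eq_mul_inv] at this
        _ ≤ 30405 * √δ * I := by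
            rw [integral_const_mul]
            gcongr
  have hmem : (Real.pi : ℂ) • star a ∈ S := by
    rw [← SetLike.mem_coe, ← hS.closure_eq, Metric.mem_closure_iff]
    intro ε hε
    let η : ℝ := ε / (2 * (30405 * (I + 1)))
    have hη : 0 < η := by positivity
    obtain ⟨G, hG, hG1⟩ := approx (η ^ 2) (by positivity)
    refine ⟨G, hG, ?_⟩
    refine lt_of_le_of_lt ((ContinuousMap.dist_le (by positivity : 0 ≤ ε/2)).2 fun x => ?_)
      (half_lt_self hε)
    rw [dist_comm, dist_eq_norm]
    refine (hG1 x).trans ?_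
    rw [Real.sqrt_sq hη.le]
    calc 30405 * η * I ≤ 30405 * η * (I + 1) := by gcongr; linarith
      _ = ε / 2 := by simp only [η]; field_simp
  have := S.smul_mem hmem ((Real.pi : ℂ)⁻¹)
  rwa [smul_smul, inv_mul_cancel₀ (by exact_mod_cast Real.pi_ne_zero), one_smul] at this

/-- The theorem of Lavrentiev. -/
theorem lavrentiev (a : C(X, ℂ)) (ha : Function.Injective a)
    (hpre : IsPreconnected (range a)ᶜ) (hint : interior (range a) = ∅) (f : C(X, ℂ))
    (ε : ℝ) (hε : 0 < ε) : ∃ p : ℂ[X], ∀ x, ‖p.eval (a x) - f x‖ < ε := by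
  let S := (Algebra.adjoin ℂ {a}).topologicalClosure
  have hS : IsClosed (S : Set C(X, ℂ)) := Subalgebra.isClosed_topologicalClosure _
  have haS : a ∈ S := Subalgebra.le_topologicalClosure _ (Algebra.subset_adjoin rfl)
  have hst := conj_mem S hS a haS hpre hint
  have h1 := ContinuousMap.starSubalgebra_topologicalClosure_eq_top_of_separatesPoints
    (StarAlgebra.adjoin ℂ {a}) (by
      intro x y hxy
      exact ⟨a, ⟨a, StarAlgebra.subset_adjoin ℂ _ rfl, rfl⟩, fun h => hxy (ha h)⟩)
  have h2 : (StarAlgebra.adjoin ℂ {a} : Set C(X, ℂ)) ⊆ S := by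
    have : (StarAlgebra.adjoin ℂ {a}).toSubalgebra ≤ S := by
      rw [StarAlgebra.adjoin_toSubalgebra]
      refine Algebra.adjoin_le ?_
      rintro g (rfl | hg)
      · exact haS
      · rw [Set.star_singleton, mem_singleton_iff] at hg
        rw [hg]; exact hst
    exact this
  have h3 : f ∈ S := by
    have : f ∈ (StarAlgebra.adjoin ℂ {a}).topologicalClosure := by rw [h1]; trivial
    have h4 : f ∈ closure (StarAlgebra.adjoin ℂ {a} : Set C(X, ℂ)) := this
    exact closure_minimal h2 hS h4
  have h4 : f ∈ closure (Algebra.adjoin ℂ {a} : Set C(X, ℂ)) := h3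
  obtain ⟨g, hg, hfg⟩ := Metric.mem_closure_iff.1 h4 ε hε
  have hg' : g ∈ Algebra.adjoin ℂ {a} := hg
  rw [Algebra.adjoin_singleton_eq_range_aeval] at hg'
  obtain ⟨p, rfl⟩ := hg'
  refine ⟨p, fun x => ?_⟩
  have h5 := (ContinuousMap.dist_lt_iff hε).1 hfg x
  rw [dist_comm, dist_eq_norm] at h5
  have h6 : (aeval a p) x = p.eval (a x) := aeval_cm_apply a p x
  rwa [← h6]

/-- If polynomials in an injective `b` with nowhere dense range are dense, then units are dense. -/
theorem units_dense (b : C(X, ℂ)) (hint : interior (range b) = ∅)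
    (hd : ∀ f : C(X, ℂ), ∀ ε : ℝ, 0 < ε → ∃ p : ℂ[X], ∀ x, ‖p.eval (b x) - f x‖ < ε)
    (f : C(X, ℂ)) (ε : ℝ) (hε : 0 < ε) : ∃ g : C(X, ℂ), (∀ x, g x ≠ 0) ∧ ∀ x, ‖g x - f x‖ < ε := by
  let M : Submonoid C(X, ℂ) :=
    { carrier := {g | ∀ x, g x ≠ 0}
      one_mem' := fun x => by simp
      mul_mem' := fun hf hg x => mul_ne_zero (hf x) (hg x) }
  have hM : ∀ g, g ∈ M ↔ ∀ x, g x ≠ 0 := fun g => Iff.rfl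
  have hconst : ∀ c : ℂ, algebraMap ℂ C(X, ℂ) c ∈ M.topologicalClosure := by
    intro c
    by_cases hc : c = 0
    · have : algebraMap ℂ C(X, ℂ) c ∈ closure (M : Set C(X, ℂ)) := by
        rw [Metric.mem_closure_iff]
        intro ε hε
        refine ⟨algebraMap ℂ C(X, ℂ) ((ε/2 : ℝ) : ℂ), (hM _).2 fun x => ?_, ?_⟩
        · simpa using hε.ne'
        · refine lt_of_le_of_lt ((ContinuousMap.dist_le (by positivity : 0 ≤ ε/2)).2 fun x => ?_)
            (half_lt_self hε)
          rw [hc, dist_eq_norm]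
          simp [abs_of_pos hε]
      exact this
    · exact M.le_topologicalClosure ((hM _).2 fun x => by simpa using hc)
  have hlin : ∀ c : ℂ, b - algebraMap ℂ C(X, ℂ) c ∈ M.topologicalClosure := by
    intro c
    have : b - algebraMap ℂ C(X, ℂ) c ∈ closure (M : Set C(X, ℂ)) := by
      rw [Metric.mem_closure_iff]
      intro ε hε
      have : Dense (range b)ᶜ := interior_eq_empty_iff_dense_compl.1 hint
      obtain ⟨c', hc', hcc⟩ := Metric.dense_iff.1 this c (ε/2) (by positivity)
      refine ⟨b - algebraMap ℂ C(X, ℂ) c', (hM _).2 fun x => ?_, ?_⟩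
      · intro h0
        exact hcc ⟨x, by simpa [sub_eq_zero] using h0⟩
      · refine lt_of_le_of_lt ((ContinuousMap.dist_le (by positivity : 0 ≤ ε/2)).2 fun x => ?_)
          (half_lt_self hε)
        rw [dist_eq_norm]
        rw [mem_ball, dist_eq_norm] at hc'
        simpa using hc'.le
    exact this
  have hpoly : ∀ p : ℂ[X], aeval b p ∈ M.topologicalClosure := by
    intro p
    have hs := IsAlgClosed.splits p
    rw [hs.eq_prod_roots]
    rw [map_mul, aeval_C, map_multiset_prod]
    refine mul_mem (hconst _) (Submonoid.multiset_prod_mem _ _ ?_)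
    intro g hg
    simp only [Multiset.map_map, Multiset.mem_map, Function.comp_apply] at hg
    obtain ⟨c, -, rfl⟩ := hg
    rw [map_sub, aeval_X, aeval_C]
    exact hlin c
  obtain ⟨p, hp⟩ := hd f (ε/2) (by positivity)
  have h1 : aeval b p ∈ closure (M : Set C(X, ℂ)) := hpoly p
  obtain ⟨g, hg, hpg⟩ := Metric.mem_closure_iff.1 h1 (ε/2) (by positivity)
  refine ⟨g, (hM g).1 hg, fun x => ?_⟩
  have h2 := (ContinuousMap.dist_lt_iff (by positivity)).1 hpg x
  have h6 : (aeval b p) x = p.eval (b x) := aeval_cm_apply b p x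
  rw [h6, dist_comm, dist_eq_norm] at h2
  have h3 := norm_add_le (g x - p.eval (b x)) (p.eval (b x) - f x)
  rw [sub_add_sub_cancel] at h3
  linarith [hp x]

theorem interior_empty (a : C(X, ℂ)) (ha : Function.Injective a)
    (hd : ∀ f : C(X, ℂ), ∀ ε : ℝ, 0 < ε → ∃ g : C(X, ℂ), (∀ x, g x ≠ 0) ∧ ∀ x, ‖g x - f x‖ < ε) :
    interior (range a) = ∅ := by
  by_contra hne
  obtain ⟨c, hc⟩ := nonempty_iff_ne_empty.2 hne
  obtain ⟨r, hr, hball⟩ := Metric.isOpen_iff.1 isOpen_interior c hc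
  obtain ⟨g, hg0, hg⟩ := hd (a - algebraMap ℂ C(X, ℂ) c) (r/2) (by positivity)
  have hemb : IsClosedEmbedding a := a.continuous.isClosedEmbedding ha
  obtain ⟨k, hk⟩ := ContinuousMap.exists_extension hemb g
  have hk' : ∀ x, k (a x) = g x := fun x => DFunLike.congr_fun hk x
  let ρ : ℂ → ℂ := fun w => ((max 1 ‖w‖ : ℝ) : ℂ)⁻¹ * w
  have hρc : Continuous ρ := by
    have : ∀ w : ℂ, ((max 1 ‖w‖ : ℝ) : ℂ) ≠ 0 := fun w => by
      have : 0 < max 1 ‖w‖ := by positivity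
      exact_mod_cast this.ne'
    exact Continuous.mul (Continuous.inv₀ (by fun_prop) this) continuous_id
  have hρ1 : ∀ w, ‖ρ w‖ ≤ 1 := fun w => by
    have h0 : 0 < max 1 ‖w‖ := by positivity
    rw [norm_mul, norm_inv, Complex.norm_real, Real.norm_of_nonneg h0.le, inv_mul_le_iff₀ h0]
    simp
  have hρ2 : ∀ w, ‖w‖ = 1 → ρ w = w := fun w hw => by simp [ρ, hw]
  have hr' : ((r/2 : ℝ) : ℂ) ≠ 0 := by exact_mod_cast (half_pos hr).ne'
  have hin : ∀ w, ∃ x, a x = c + ((r/2 : ℝ) : ℂ) * ρ w := fun w => by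
    have : c + ((r/2 : ℝ) : ℂ) * ρ w ∈ ball c r := by
      rw [mem_ball, dist_eq_norm, add_sub_cancel_left, norm_mul, Complex.norm_real,
        Real.norm_of_nonneg (half_pos hr).le]
      nlinarith [hρ1 w]
    have h := interior_subset (hball this)
    exact h
  refine no_ext (fun w => k (c + ((r/2 : ℝ) : ℂ) * ρ w) / ((r/2 : ℝ) : ℂ)) (by fun_prop) ?_ ?_
  · intro w
    obtain ⟨x, hx⟩ := hin w
    rw [← hx, hk']
    exact div_ne_zero (hg0 x) hr'
  · intro w hw
    obtain ⟨x, hx⟩ := hin w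
    have h1 := hg x
    simp only [← hx, hk']
    have h2 : a x - c = ((r/2 : ℝ) : ℂ) * w := by rw [hx, hρ2 w hw]; ring
    have h3 : g x / ((r/2 : ℝ) : ℂ) - w = (g x - (a x - c)) / ((r/2 : ℝ) : ℂ) := by
      rw [h2]; field_simp
    rw [h3, norm_div, Complex.norm_real, Real.norm_of_nonneg (half_pos hr).le,
      div_lt_one (half_pos hr)]
    simpa using h1

theorem poly_dense (P : Set ℂ) (hP : IsCompact P) [ContractibleSpace P] (hint : interior P = ∅)
    (a : C(P, ℂ)) (ha : Function.Injective a) (f : C(P, ℂ)) (ε : ℝ) (hε : 0 < ε) :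
    ∃ p : ℂ[X], ∀ x, ‖p.eval (a x) - f x‖ < ε := by
  have : CompactSpace P := isCompact_iff_compactSpace.1 hP
  let b : C(P, ℂ) := ⟨Subtype.val, continuous_subtype_val⟩
  have hb : Function.Injective b := Subtype.val_injective
  have hbr : range b = P := Subtype.range_val
  have hbi : interior (range b) = ∅ := by rw [hbr, hint]
  have h1 := lavrentiev b hb (compl_preconn b hb) hbi
  have h2 := interior_empty a ha (units_dense b hbi h1)
  exact lavrentiev a ha (compl_preconn a ha) h2 f ε hε
end lavrentiev


theorem aeval_tri {n : ℕ} (M : Matrix (Fin n) (Fin n) ℂ) (hM : ∀ i j, j < i → M i j = 0)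
    (p : ℂ[X]) : (∀ i j, j < i → (aeval M p) i j = 0) ∧
      ∀ i, (aeval M p) i i = p.eval (M i i) := by
  induction p using Polynomial.induction_on with
  | C c =>
    refine ⟨fun i j h => ?_, fun i => ?_⟩
    · rw [aeval_C, Matrix.algebraMap_matrix_apply, if_neg h.ne']
    · rw [aeval_C, Matrix.algebraMap_matrix_apply, if_pos rfl, eval_C]; rfl
  | add p q hp hq =>
    refine ⟨fun i j h => ?_, fun i => ?_⟩
    · rw [map_add, Matrix.add_apply, hp.1 i j h, hq.1 i j h, add_zero]
    · rw [map_add, Matrix.add_apply, hp.2 i, hq.2 i, eval_add]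
  | monomial k c h =>
    have e : (C c * X ^ (k+1) : ℂ[X]) = (C c * X ^ k) * X := by rw [pow_succ, mul_assoc]
    rw [e, map_mul, aeval_X]
    refine ⟨fun i j hij => ?_, fun i => ?_⟩
    · rw [Matrix.mul_apply]
      refine Finset.sum_eq_zero fun l _ => ?_
      rcases lt_or_ge l i with hl | hl
      · rw [h.1 i l hl, zero_mul]
      · rw [hM l j (hij.trans_le hl), mul_zero]
    · rw [Matrix.mul_apply, Finset.sum_eq_single i, h.2 i, eval_mul_X]
      · intro l _ hl
        rcases lt_or_gt_of_ne hl with hl | hl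
        · rw [h.1 i l hl, zero_mul]
        · rw [hM l i hl, mul_zero]
      · simp

theorem aeval_cont {X : Type*} [TopologicalSpace X] {n : ℕ} (A : X → Matrix (Fin n) (Fin n) ℂ)
    (hA : Continuous A) (p : ℂ[X]) : Continuous fun x => aeval (A x) p := by
  simp only [aeval_eq_sum_range]
  refine continuous_finsetSum _ fun i _ => ?_
  exact (continuous_const_smul (p.coeff i)).comp (hA.pow i)

theorem diag_ne {n : ℕ} (M : Matrix (Fin n) (Fin n) ℂ) (hM : ∀ i j, j < i → M i j = 0)
    (hr : M.rank = n) (i : Fin n) : M i i ≠ 0 := by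
  have h1 : IsUnit M := by
    rw [← Matrix.mulVec_surjective_iff_isUnit]
    have h3 : LinearMap.range M.mulVecLin = ⊤ :=
      Submodule.eq_top_of_finrank_eq (by rw [Module.finrank_fin_fun]; exact hr)
    exact LinearMap.range_eq_top.1 h3
  have h2 : M.det ≠ 0 := ((Matrix.isUnit_iff_isUnit_det M).1 h1).ne_zero
  rw [Matrix.det_of_isUpperTriangular (fun i j h => hM i j h)] at h2
  exact Finset.prod_ne_zero_iff.1 h2 i (Finset.mem_univ i)

theorem tri_step {n : ℕ} (P : Set ℂ) (hP : IsCompact P)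
    [ContractibleSpace P] (hint : interior P = ∅)
    (A B : P → Matrix (Fin n) (Fin n) ℂ) (hA : Continuous A) (hB : Continuous B)
    (hAtri : ∀ (θ : P) (i j : Fin n), j < i → A θ i j = 0)
    (hBtri : ∀ (θ : P) (i j : Fin n), j < i → B θ i j = 0)
    (hBrank : ∀ θ : P, (B θ).rank = n)
    (hdiag : ∀ i : Fin n, Function.Injective fun θ : P => A θ i i) (k : ℕ) :
    k ≤ n → ∀ f : P → Fin n → ℂ, Continuous f → (∀ θ (i : Fin n), k ≤ i → f θ i = 0) →
      ∀ ε : ℝ, 0 < ε → ∃ p : Fin n → ℂ[X], ∀ θ : P,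
      ‖(∑ j, (Polynomial.aeval (A θ) (p j)).mulVec fun i => B θ i j) - f θ‖ < ε := by
  induction k with
  | zero =>
    intro _ f _ hf ε hε
    refine ⟨0, fun θ => ?_⟩
    have : f θ = 0 := funext fun i => hf θ i (Nat.zero_le _)
    simpa [this] using hε
  | succ k ih =>
    intro hk f hfc hf ε hε
    have : CompactSpace P := isCompact_iff_compactSpace.1 hP
    let j : Fin n := ⟨k, hk⟩
    have hbc : Continuous fun θ => B θ j j := hB.matrix_elem j j
    have hb0 : ∀ θ, B θ j j ≠ 0 := fun θ => diag_ne (B θ) (hBtri θ) (hBrank θ) j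
    obtain ⟨M, hM⟩ : ∃ M : ℝ, ∀ θ, ‖B θ j j‖ ≤ M := by
      obtain ⟨M, hM⟩ := isCompact_univ.exists_bound_of_continuousOn (f := fun θ => B θ j j) hbc.continuousOn
      exact ⟨M, fun θ => hM θ (mem_univ _)⟩
    have hM' : 0 < |M| + 1 := by positivity
    have hfj : Continuous fun θ => f θ j := (continuous_apply j).comp hfc
    obtain ⟨q, hq⟩ := poly_dense P hP hint ⟨fun θ => A θ j j, hA.matrix_elem j j⟩ (hdiag j)
      ⟨fun θ => f θ j / B θ j j, hfj.div hbc hb0⟩ (ε / 2 / (|M| + 1)) (by positivity)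
    simp only [ContinuousMap.coe_mk] at hq
    let v : P → Fin n → ℂ := fun θ => (aeval (A θ) q).mulVec fun i => B θ i j
    have hvc : Continuous v := (aeval_cont A hA q).matrix_mulVec
      (continuous_pi fun i => hB.matrix_elem i j)
    have hv0 : ∀ θ i, j < i → v θ i = 0 := fun θ i hi => by
      change ∑ l, (aeval (A θ) q) i l * B θ l j = 0
      refine Finset.sum_eq_zero fun l _ => ?_
      rcases lt_or_ge l i with hl | hl
      · simp only [(aeval_tri (A θ) (hAtri θ) q).1 i l hl, zero_mul]
      · simp only [hBtri θ l j (hi.trans_le hl), mul_zero]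
    have hvj : ∀ θ, v θ j = q.eval (A θ j j) * B θ j j := fun θ => by
      rw [← (aeval_tri (A θ) (hAtri θ) q).2 j]
      change ∑ l, (aeval (A θ) q) j l * B θ l j = _
      refine Finset.sum_eq_single j ?_ (by simp)
      intro l _ hl
      rcases lt_or_gt_of_ne hl with hl | hl
      · simp only [(aeval_tri (A θ) (hAtri θ) q).1 j l hl, zero_mul]
      · simp only [hBtri θ l j hl, mul_zero]
    let g : P → Fin n → ℂ := fun θ i => if k ≤ i then 0 else f θ i - v θ i
    have hgc : Continuous g := by
      refine continuous_pi fun i => ?_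
      by_cases h : k ≤ i
      · simp only [g, if_pos h]; exact continuous_const
      · simp only [g, if_neg h]
        exact ((continuous_apply i).comp hfc).sub ((continuous_apply i).comp hvc)
    obtain ⟨p, hp⟩ := ih (by omega) g hgc (fun θ i h => if_pos h) (ε/2) (by positivity)
    refine ⟨p + Pi.single j q, fun θ => ?_⟩
    have e1 : (∑ l, (aeval (A θ) ((p + Pi.single j q : Fin n → ℂ[X]) l)).mulVec fun i => B θ i l)
        = (∑ l, (aeval (A θ) (p l)).mulVec fun i => B θ i l) + v θ := by
      simp only [Pi.add_apply, map_add, Matrix.add_mulVec, Finset.sum_add_distrib]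
      congr 1
      rw [Finset.sum_eq_single j]
      · simp [v]
      · intro l _ hl
        simp [Pi.single_eq_of_ne hl]
      · simp
    have e2 : ‖g θ + v θ - f θ‖ ≤ ε / 2 := by
      rw [pi_norm_le_iff_of_nonneg (by positivity)]
      intro i
      simp only [Pi.sub_apply, Pi.add_apply]
      rcases lt_trichotomy i j with h | h | h
      · have h' : ¬ k ≤ i := not_le.2 h
        simp only [g, if_neg h']
        rw [sub_add_cancel, sub_self, norm_zero]; positivity
      · subst h
        have h' : g θ j = 0 := if_pos (le_refl k)
        rw [h', zero_add, hvj]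
        have e3 : q.eval (A θ j j) * B θ j j - f θ j
            = (q.eval (A θ j j) - f θ j / B θ j j) * B θ j j := by
          rw [sub_mul, div_mul_cancel₀ _ (hb0 θ)]
        rw [e3, norm_mul]
        calc _ ≤ (ε / 2 / (|M| + 1)) * (|M| + 1) := by
              gcongr
              · exact (hq θ).le
              · linarith [hM θ, le_abs_self M]
          _ = ε / 2 := div_mul_cancel₀ _ hM'.ne'
      · have h' : k ≤ i := le_of_lt h
        have h1 : g θ i = 0 := if_pos h'
        rw [h1, hv0 θ i h, hf θ i h]
        simp; positivity
    rw [e1]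
    have e4 := norm_add_le ((∑ l, (aeval (A θ) (p l)).mulVec fun i => B θ i l) - g θ)
      (g θ + v θ - f θ)
    have e5 : ((∑ l, (aeval (A θ) (p l)).mulVec fun i => B θ i l) - g θ) + (g θ + v θ - f θ)
      = (∑ l, (aeval (A θ) (p l)).mulVec fun i => B θ i l) + v θ - f θ := by abel
    rw [e5] at e4
    linarith [hp θ]

end Lav

/-- an upper triangular pair `(A, B)` over a nonempty compact contractible
parameter set with empty interior is uniformly ensemble reachable provided `B(θ)` has
full rank `n` for every `θ` and every diagonal entry of `A` is injective in `θ`. -/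
theorem stmt_13 {n : ℕ} (P : Set ℂ) (hP : IsCompact P) (hPne : P.Nonempty)
    [ContractibleSpace P] (hint : interior P = ∅)
    (A B : P → Matrix (Fin n) (Fin n) ℂ) (hA : Continuous A) (hB : Continuous B)
    (hAtri : ∀ (θ : P) (i j : Fin n), j < i → A θ i j = 0)
    (hBtri : ∀ (θ : P) (i j : Fin n), j < i → B θ i j = 0)
    (hBrank : ∀ θ : P, (B θ).rank = n)
    (hdiag : ∀ i : Fin n, Function.Injective fun θ : P => A θ i i) :
    UniformEnsembleReachable P A B := by
  intro f hf ε hε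
  exact Lav.tri_step P hP hint A B hA hB hAtri hBtri hBrank hdiag n le_rfl f hf
    (fun θ i h => absurd i.2 (not_lt.2 h)) ε hε
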